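/- Let u ∈ A_1 and let v be a weight on ℝ^n; let uv denote the measure with density u·v. Let Ψ be a Young function (convex, strictly increasing bijection of [0,∞) with Ψ(0)=0) and define N(h) := ∫_0^∞ h*_{uv}(s)/Ψ^{-1}(1/s) ds/s. Let S h := M(hu)/u (defined a.e., since u>0 a.e.), and suppose there is K_0>0 such that N(Sh) ≤ K_0 N(h) for all measurable h. For nonnegative measurable h with N(h)<∞, define Rh := Σ_{k=0}^∞ S^k h/(2^k K_0^k), where S^0 is the identity. Then: (i) h(x) ≤ Rh(x) a.e.; (ii) N(Rh) ≤ 2 N(h); (iii) S(Rh)(x) ≤ 2K_0 · Rh(x) a.e., equivalently M((Rh)·u)(x) ≤ 2K_0 · Rh(x)u(x) a.e.; in particular (Rh)·u ∈ A_1 with [(Rh)·u]_{A_1} ≤ 2K_0. -/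

import Mathlib

open MeasureTheory Set
open scoped ENNReal

noncomputable section

/-- A cube in `ℝⁿ` with center `c` and half side length `r`. -/
def cube {n : ℕ} (c : Fin n → ℝ) (r : ℝ) : Set (Fin n → ℝ) := {y | ∀ i, |y i - c i| ≤ r}

/-- The (uncentered) Hardy–Littlewood maximal operator over cubes. -/
def maximal {n : ℕ} (f : (Fin n → ℝ) → ℝ) (x : Fin n → ℝ) : ℝ≥0∞ :=
  ⨆ (c : Fin n → ℝ) (r : ℝ) (_ : 0 < r) (_ : x ∈ cube c r),
    (volume (cube c r))⁻¹ * ∫⁻ y in cube c r, ENNReal.ofReal |f y|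

/-- A weight: a locally integrable a.e.-positive function on `ℝⁿ`. -/
def IsWeight {n : ℕ} (w : (Fin n → ℝ) → ℝ) : Prop :=
  LocallyIntegrable w volume ∧ ∀ᵐ x, 0 < w x

/-- The `A₁` constant `‖Mw/w‖_{L^∞}`. -/
def A1const {n : ℕ} (w : (Fin n → ℝ) → ℝ) : ℝ≥0∞ :=
  essSup (fun x => maximal w x / ENNReal.ofReal (w x)) volume

def MemA1 {n : ℕ} (w : (Fin n → ℝ) → ℝ) : Prop :=
  IsWeight w ∧ A1const w < ⊤

/-- The `A_p` constant, `1 < p < ∞`. -/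
def ApConst {n : ℕ} (p : ℝ) (w : (Fin n → ℝ) → ℝ) : ℝ≥0∞ :=
  ⨆ (c : Fin n → ℝ) (r : ℝ) (_ : 0 < r),
    ((volume (cube c r))⁻¹ * ∫⁻ y in cube c r, ENNReal.ofReal (w y)) *
      ((volume (cube c r))⁻¹ * ∫⁻ y in cube c r,
          ENNReal.ofReal (w y ^ (-1 / (p - 1)))) ^ (p - 1)

def MemAp {n : ℕ} (p : ℝ) (w : (Fin n → ℝ) → ℝ) : Prop :=
  IsWeight w ∧ ApConst p w < ⊤

/-- `A_∞ = ⋃_{p ≥ 1} A_p`. -/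
def MemAinfty {n : ℕ} (w : (Fin n → ℝ) → ℝ) : Prop :=
  MemA1 w ∨ ∃ p : ℝ, 1 < p ∧ MemAp p w

/-- The measure with density `u·v` with respect to Lebesgue measure. -/
def wMeasure {n : ℕ} (u v : (Fin n → ℝ) → ℝ) : Measure (Fin n → ℝ) :=
  volume.withDensity (fun x => ENNReal.ofReal (u x * v x))

/-- The weak Orlicz quasinorm `‖f‖_{L^{A,∞}(μ)}`. -/
def weakOrliczNorm {X : Type*} [MeasurableSpace X] (A : ℝ → ℝ) (μ : Measure X)
    (f : X → ℝ) : ℝ≥0∞ :=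
  sInf {l : ℝ≥0∞ | ∀ t : ℝ, 0 < t →
    ENNReal.ofReal (A t) * μ {x | l * ENNReal.ofReal t < ENNReal.ofReal |f x|} ≤ 1}

/-- The Luxemburg norm `‖f‖_{A(μ)}`. -/
def luxemburgNorm {X : Type*} [MeasurableSpace X] (A : ℝ → ℝ) (μ : Measure X)
    (f : X → ℝ) : ℝ≥0∞ :=
  sInf {l : ℝ≥0∞ | ∃ lr : ℝ, 0 < lr ∧ l = ENNReal.ofReal lr ∧
    ∫⁻ x, ENNReal.ofReal (A (|f x| / lr)) ∂μ ≤ 1}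

/-- The decreasing rearrangement `f^*_μ`. -/
def rearrangement {X : Type*} [MeasurableSpace X] (μ : Measure X) (f : X → ℝ)
    (s : ℝ) : ℝ≥0∞ :=
  sInf {t : ℝ≥0∞ | μ {x | t < ENNReal.ofReal |f x|} ≤ ENNReal.ofReal s}


/-- The Hardy–Littlewood maximal operator over cubes for `ℝ≥0∞`-valued functions. -/
def maximalE {n : ℕ} (f : (Fin n → ℝ) → ℝ≥0∞) (x : Fin n → ℝ) : ℝ≥0∞ :=
  ⨆ (c : Fin n → ℝ) (r : ℝ) (_ : 0 < r) (_ : x ∈ cube c r),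
    (volume (cube c r))⁻¹ * ∫⁻ y in cube c r, f y

/-- The `A₁` constant of an `ℝ≥0∞`-valued weight. -/
def A1constE {n : ℕ} (w : (Fin n → ℝ) → ℝ≥0∞) : ℝ≥0∞ :=
  essSup (fun x => maximalE w x / w x) volume

/-- The decreasing rearrangement of an `ℝ≥0∞`-valued function. -/
def rearrangementE {X : Type*} [MeasurableSpace X] (μ : Measure X) (h : X → ℝ≥0∞)
    (s : ℝ) : ℝ≥0∞ :=
  sInf {t : ℝ≥0∞ | μ {x | t < h x} ≤ ENNReal.ofReal s}

/-- The operator `S h = M(hu)/u`. -/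
def Sop {n : ℕ} (u : (Fin n → ℝ) → ℝ) (h : (Fin n → ℝ) → ℝ≥0∞) :
    (Fin n → ℝ) → ℝ≥0∞ :=
  fun x => maximalE (fun y => h y * ENNReal.ofReal (u y)) x / ENNReal.ofReal (u x)

/-- The Rubio de Francia iteration `R h = Σ_k S^k h / (2^k K₀^k)`. -/
def Rop {n : ℕ} (u : (Fin n → ℝ) → ℝ) (K₀ : ℝ) (h : (Fin n → ℝ) → ℝ≥0∞) :
    (Fin n → ℝ) → ℝ≥0∞ :=
  fun x => ∑' k : ℕ, (Sop u)^[k] h x / ENNReal.ofReal (2 * K₀) ^ k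

/-- The functional `N(h) = ∫_0^∞ h^*_{uv}(s)/Ψ⁻¹(1/s) ds/s`. -/
def NNorm {n : ℕ} (u v : (Fin n → ℝ) → ℝ) (Ψ : ℝ → ℝ) (h : (Fin n → ℝ) → ℝ≥0∞) : ℝ≥0∞ :=
  ∫⁻ s in Set.Ioi (0 : ℝ),
    rearrangementE (wMeasure u v) h s /
        ENNReal.ofReal (Function.invFunOn Ψ (Set.Ici 0) (1 / s)) / ENNReal.ofReal s

/-- A Young function: a convex, strictly increasing bijection of `[0,∞)` vanishing at `0`. -/
structure IsYoung (A : ℝ → ℝ) : Prop where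
  convex : ConvexOn ℝ (Set.Ici 0) A
  strictMono : StrictMonoOn A (Set.Ici 0)
  zero : A 0 = 0
  bij : Set.BijOn A (Set.Ici 0) (Set.Ici 0)


lemma lt_rearrangementE_iff {X : Type*} [MeasurableSpace X] {μ : Measure X} {h : X → ℝ≥0∞}
    {r : ℝ≥0∞} {s : ℝ} :
    r < rearrangementE μ h s ↔ ENNReal.ofReal s < μ {x | r < h x} := by
  constructor
  · contrapose!
    exact fun hr => sInf_le hr
  · contrapose!
    intro hr
    rcases eq_or_ne r ⊤ with rfl | hr_top
    · simp
    obtain ⟨t, ht_anti, ht_mem, ht_lim⟩ := exists_seq_strictAnti_tendsto' hr_top.lt_top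
    have hset : {x | r < h x} = ⋃ k, {x | t k < h x} := by
      ext x
      simp only [mem_ofPred_eq, mem_iUnion]
      exact ⟨fun hx => (ht_lim.eventually (gt_mem_nhds hx)).exists,
        fun ⟨k, hk⟩ => (ht_mem k).1.trans hk⟩
    have hmono : Monotone fun k => {x | t k < h x} :=
      fun i j hij x hx => (ht_anti.antitone hij).trans_lt hx
    rw [hset, hmono.measure_iUnion]
    refine iSup_le fun k => ?_
    obtain ⟨q, hq, hqt⟩ := sInf_lt_iff.1 (hr.trans_lt (ht_mem k).1)
    exact (measure_mono fun x hx => hqt.trans hx).trans hq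

lemma antitone_rearrangementE {X : Type*} [MeasurableSpace X] (μ : Measure X) (h : X → ℝ≥0∞) :
    Antitone (rearrangementE μ h) := fun _ _ hst =>
  sInf_le_sInf fun _ ht => le_trans ht (ENNReal.ofReal_le_ofReal hst)

lemma rearrangementE_congr_ae {X : Type*} [MeasurableSpace X] {μ : Measure X} {f g : X → ℝ≥0∞}
    (hfg : f =ᵐ[μ] g) : rearrangementE μ f = rearrangementE μ g := by
  ext s
  have (t : ℝ≥0∞) : μ {x | t < f x} = μ {x | t < g x} :=
    measure_congr <| by
      filter_upwards [hfg] with x hx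
      exact congrArg (t < ·) hx
  simp only [rearrangementE, this]

lemma rearrangementE_const_mul_le {X : Type*} [MeasurableSpace X] (μ : Measure X) (h : X → ℝ≥0∞)
    {c : ℝ≥0∞} (hc₀ : c ≠ 0) (hc : c ≠ ⊤) (s : ℝ) :
    rearrangementE μ (fun x => c * h x) s ≤ c * rearrangementE μ h s := by
  rw [← not_lt, lt_rearrangementE_iff, not_lt]
  have hset : {x | c * rearrangementE μ h s < c * h x} = {x | rearrangementE μ h s < h x} := by
    ext x
    exact ENNReal.mul_lt_mul_iff_right hc₀ hc
  rw [hset, ← not_lt, ← lt_rearrangementE_iff]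
  exact lt_irrefl _

lemma volume_setOf_ofReal_lt (a : ℝ≥0∞) :
    volume ({r | ENNReal.ofReal r < a} ∩ Ioi (0 : ℝ)) = a := by
  rcases eq_or_ne a ⊤ with rfl | ha
  · simp
  · have : {r | ENNReal.ofReal r < a} ∩ Ioi (0 : ℝ) = Ioo 0 a.toReal := by
      ext r
      simp only [mem_inter_iff, mem_ofPred_eq, mem_Ioi, mem_Ioo]
      constructor
      · exact fun ⟨h₁, h₂⟩ => ⟨h₂, (ENNReal.ofReal_lt_iff_lt_toReal h₂.le ha).1 h₁⟩
      · exact fun ⟨h₁, h₂⟩ => ⟨(ENNReal.ofReal_lt_iff_lt_toReal h₁.le ha).2 h₂, h₁⟩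
    rw [this, Real.volume_Ioo, sub_zero, ENNReal.ofReal_toReal ha]

lemma lintegral_mul_eq_lintegral_setLIntegral_lt {X : Type*} [MeasurableSpace X] (μ : Measure X)
    [SFinite μ] {f g : X → ℝ≥0∞} (hf : Measurable f) (hg : Measurable g) :
    ∫⁻ x, g x * f x ∂μ =
      ∫⁻ r in Ioi (0 : ℝ), ∫⁻ x in {x | ENNReal.ofReal r < f x}, g x ∂μ := by
  have hE : MeasurableSet {p : X × ℝ | ENNReal.ofReal p.2 < f p.1} :=
    measurableSet_lt (by fun_prop) (by fun_prop)
  calc ∫⁻ x, g x * f x ∂μ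
      = ∫⁻ x, (∫⁻ r in Ioi (0 : ℝ),
          {p : X × ℝ | ENNReal.ofReal p.2 < f p.1}.indicator (fun p => g p.1) (x, r)) ∂μ := by
        refine lintegral_congr fun x => ?_
        have hm : MeasurableSet {r : ℝ | ENNReal.ofReal r < f x} :=
          measurableSet_lt (by fun_prop) (by fun_prop)
        have := lintegral_indicator_const (μ := volume.restrict (Ioi (0 : ℝ))) hm (g x)
        rw [Measure.restrict_apply hm, volume_setOf_ofReal_lt] at this
        exact this.symm
    _ = ∫⁻ r in Ioi (0 : ℝ), ∫⁻ x,
          {p : X × ℝ | ENNReal.ofReal p.2 < f p.1}.indicator (fun p => g p.1) (x, r) ∂μ :=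
        lintegral_lintegral_swap
          (((hg.comp measurable_fst).indicator hE).aemeasurable)
    _ = _ := by
        refine lintegral_congr fun r => ?_
        rw [← lintegral_indicator (measurableSet_lt measurable_const hf)]
        rfl

lemma lintegral_tsub_const_eq {X : Type*} [MeasurableSpace X] (μ : Measure X)
    [SFinite μ] {f : X → ℝ≥0∞} (hf : Measurable f) (l : ℝ≥0∞) :
    ∫⁻ x, (f x - l) ∂μ = ∫⁻ r in Ioi (0 : ℝ), μ {x | ENNReal.ofReal r + l < f x} := by
  have := lintegral_mul_eq_lintegral_setLIntegral_lt μ (f := fun x => f x - l) (g := 1)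
    (by fun_prop) measurable_one
  simpa [lt_tsub_iff_right] using this

/-- A function and its decreasing rearrangement are equimeasurable, so their truncations have the
same integral. -/
lemma lintegral_rearrangementE_tsub {X : Type*} [MeasurableSpace X] (μ : Measure X)
    [SFinite μ] {h : X → ℝ≥0∞} (hh : Measurable h) (l : ℝ≥0∞) :
    ∫⁻ s in Ioi (0 : ℝ), (rearrangementE μ h s - l) = ∫⁻ x, (h x - l) ∂μ := by
  have hm := (antitone_rearrangementE μ h).measurable
  rw [lintegral_tsub_const_eq _ hm, lintegral_tsub_const_eq μ hh]
  refine lintegral_congr fun r => ?_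
  rw [Measure.restrict_apply (measurableSet_lt measurable_const hm)]
  simp only [lt_rearrangementE_iff]
  exact volume_setOf_ofReal_lt _

lemma setLIntegral_rearrangementE_le {X : Type*} [MeasurableSpace X] (μ : Measure X)
    [SFinite μ] {h : X → ℝ≥0∞} (hh : Measurable h) {D : Set ℝ} (hD : D ⊆ Ioi 0) (l : ℝ≥0∞) :
    ∫⁻ s in D, rearrangementE μ h s ≤ ∫⁻ x, (h x - l) ∂μ + l * volume D := by
  have hm := (antitone_rearrangementE μ h).measurable
  calc ∫⁻ s in D, rearrangementE μ h s
      ≤ ∫⁻ s in D, ((rearrangementE μ h s - l) + l) := lintegral_mono fun s => le_tsub_add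
    _ = (∫⁻ s in D, (rearrangementE μ h s - l)) + l * volume D := by
        rw [lintegral_add_right _ measurable_const, setLIntegral_const]
    _ ≤ (∫⁻ s in Ioi (0 : ℝ), (rearrangementE μ h s - l)) + l * volume D := by
        gcongr
    _ = _ := by rw [lintegral_rearrangementE_tsub μ hh]

lemma exists_setLIntegral_rearrangementE_eq {X : Type*} [MeasurableSpace X] (μ : Measure X)
    [SFinite μ] {h : X → ℝ≥0∞} (hh : Measurable h) {D : Set ℝ} (hDm : MeasurableSet D)
    (hD : ∀ s ∈ D, ∀ t, 0 < t → t ≤ s → t ∈ D) :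
    ∃ l, ∫⁻ x, (h x - l) ∂μ + l * volume D ≤ ∫⁻ s in D, rearrangementE μ h s := by
  refine ⟨⨅ s ∈ D, rearrangementE μ h s, ?_⟩
  set l := ⨅ s ∈ D, rearrangementE μ h s with hl
  have hcut : ∀ s ∈ Ioi (0 : ℝ), rearrangementE μ h s - l =
      D.indicator (fun s => rearrangementE μ h s - l) s := by
    intro s hs
    by_cases hsD : s ∈ D
    · rw [indicator_of_mem hsD]
    · rw [indicator_of_notMem hsD, tsub_eq_zero_iff_le]
      refine le_iInf₂ fun t ht => antitone_rearrangementE μ h ?_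
      by_contra! hst
      exact hsD (hD t ht s hs hst.le)
  calc ∫⁻ x, (h x - l) ∂μ + l * volume D
      = (∫⁻ s in Ioi (0 : ℝ), D.indicator (fun s => rearrangementE μ h s - l) s) +
          l * volume D := by
        rw [← lintegral_rearrangementE_tsub μ hh, setLIntegral_congr_fun measurableSet_Ioi hcut]
    _ ≤ (∫⁻ s in D, (rearrangementE μ h s - l)) + l * volume D := by
        refine add_le_add_left ?_ _
        rw [← lintegral_indicator hDm]
        exact setLIntegral_le_lintegral _ _
    _ = ∫⁻ s in D, ((rearrangementE μ h s - l) + l) := by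
        rw [lintegral_add_right _ measurable_const, setLIntegral_const]
    _ = _ := setLIntegral_congr_fun hDm fun s hs => tsub_add_cancel_of_le (iInf₂_le s hs)

lemma setLIntegral_rearrangementE_tsum_le {X : Type*} [MeasurableSpace X] (μ : Measure X)
    [SFinite μ] {h : ℕ → X → ℝ≥0∞} (hh : ∀ k, Measurable (h k)) {D : Set ℝ}
    (hDm : MeasurableSet D) (hD₀ : D ⊆ Ioi 0) (hD : ∀ s ∈ D, ∀ t, 0 < t → t ≤ s → t ∈ D) :
    ∫⁻ s in D, rearrangementE μ (fun x => ∑' k, h k x) s ≤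
      ∑' k, ∫⁻ s in D, rearrangementE μ (h k) s := by
  choose l hl using fun k => exists_setLIntegral_rearrangementE_eq μ (hh k) hDm hD
  calc ∫⁻ s in D, rearrangementE μ (fun x => ∑' k, h k x) s
      ≤ ∫⁻ x, (∑' k, h k x - ∑' k, l k) ∂μ + (∑' k, l k) * volume D :=
        setLIntegral_rearrangementE_le μ (by fun_prop) hD₀ _
    _ ≤ ∫⁻ x, ∑' k, (h k x - l k) ∂μ + (∑' k, l k) * volume D := by
        gcongr with x
        rw [tsub_le_iff_right, ← ENNReal.tsum_add]
        exact ENNReal.tsum_le_tsum fun k => le_tsub_add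
    _ = ∑' k, (∫⁻ x, (h k x - l k) ∂μ + l k * volume D) := by
        rw [lintegral_tsum fun k => ((hh k).sub_const _).aemeasurable, ENNReal.tsum_add,
          ENNReal.tsum_mul_right]
    _ ≤ _ := ENNReal.tsum_le_tsum hl

/-- A Lorentz functional with decreasing weight is countably subadditive. -/
lemma lintegral_rearrangementE_tsum_mul_le {X : Type*} [MeasurableSpace X] (μ : Measure X)
    [SFinite μ] {h : ℕ → X → ℝ≥0∞} (hh : ∀ k, Measurable (h k)) {φ : ℝ → ℝ≥0∞}
    (hφ : Antitone φ) :
    ∫⁻ s in Ioi (0 : ℝ), rearrangementE μ (fun x => ∑' k, h k x) s * φ s ≤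
      ∑' k, ∫⁻ s in Ioi (0 : ℝ), rearrangementE μ (h k) s * φ s := by
  have key (f : X → ℝ≥0∞) := lintegral_mul_eq_lintegral_setLIntegral_lt
    (volume.restrict (Ioi (0 : ℝ))) hφ.measurable (antitone_rearrangementE μ f).measurable
  have hDm (r : ℝ) : MeasurableSet {s | ENNReal.ofReal r < φ s} :=
    measurableSet_lt measurable_const hφ.measurable
  have hmeas (f : X → ℝ≥0∞) : Measurable fun r : ℝ =>
      ∫⁻ s in {s | ENNReal.ofReal r < φ s}, rearrangementE μ f s ∂volume.restrict (Ioi 0) :=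
    Antitone.measurable fun r t hrt => lintegral_mono_set fun s hs =>
      (ENNReal.ofReal_le_ofReal hrt).trans_lt hs
  simp only [key]
  rw [← lintegral_tsum fun k => (hmeas (h k)).aemeasurable]
  refine lintegral_mono fun r => ?_
  simp only [Measure.restrict_restrict (hDm r)]
  refine setLIntegral_rearrangementE_tsum_le μ hh ((hDm r).inter measurableSet_Ioi)
    inter_subset_right ?_
  exact fun s hs t ht hts => ⟨lt_of_lt_of_le hs.1 (hφ hts), ht⟩

lemma IsYoung.antitone_inv_mul {Ψ : ℝ → ℝ} (hΨ : IsYoung Ψ) :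
    AntitoneOn (fun s : ℝ => (ENNReal.ofReal (Function.invFunOn Ψ (Ici 0) (1 / s)))⁻¹ *
      (ENNReal.ofReal s)⁻¹) (Ioi 0) := by
  intro s hs t ht hst
  have hs : 0 < s := hs
  have ht : 0 < t := ht
  have hmem {r : ℝ} (hr : 0 < r) : 0 < Function.invFunOn Ψ (Ici 0) (1 / r) ∧
      Ψ (Function.invFunOn Ψ (Ici 0) (1 / r)) = 1 / r := by
    have hr' : 1 / r ∈ Ψ '' Ici 0 := hΨ.bij.surjOn (by simpa using hr.le)
    have hx : 0 ≤ Function.invFunOn Ψ (Ici 0) (1 / r) := Function.invFunOn_mem hr'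
    have heq := Function.invFunOn_eq hr'
    refine ⟨hx.lt_of_ne fun h0 => ?_, heq⟩
    rw [← h0, hΨ.zero] at heq
    exact (one_div_pos.2 hr).ne heq
  obtain ⟨hx, hxs⟩ := hmem hs
  obtain ⟨hy, hyt⟩ := hmem ht
  set x := Function.invFunOn Ψ (Ici 0) (1 / s)
  set y := Function.invFunOn Ψ (Ici 0) (1 / t)
  have hyx : y ≤ x := by
    rw [← hΨ.strictMono.le_iff_le hy.le hx.le, hxs, hyt]
    exact one_div_le_one_div_of_le hs hst
  have hsec := hΨ.convex.secant_mono (a := 0) (by simp) hy.le hx.le hy.ne' hx.ne' hyx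
  rw [hΨ.zero, hxs, hyt, sub_zero, sub_zero, sub_zero, sub_zero, div_div, div_div] at hsec
  have hmul : x * s ≤ y * t := by
    rw [one_div_le_one_div (by positivity) (by positivity)] at hsec
    linarith
  simp only
  rw [← ENNReal.mul_inv (by simp) (by simp), ← ENNReal.mul_inv (by simp) (by simp),
    ENNReal.inv_le_inv, ← ENNReal.ofReal_mul hx.le, ← ENNReal.ofReal_mul hy.le]
  exact ENNReal.ofReal_le_ofReal hmul

lemma NNorm_congr_ae {n : ℕ} {u v : (Fin n → ℝ) → ℝ} {Ψ : ℝ → ℝ} {f g : (Fin n → ℝ) → ℝ≥0∞}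
    (hfg : f =ᵐ[volume] g) : NNorm u v Ψ f = NNorm u v Ψ g := by
  have hfg' : f =ᵐ[wMeasure u v] g := (withDensity_absolutelyContinuous volume _).ae_le hfg
  simp only [NNorm, rearrangementE_congr_ae hfg']

lemma NNorm_const_mul_le {n : ℕ} (u v : (Fin n → ℝ) → ℝ) (Ψ : ℝ → ℝ) (f : (Fin n → ℝ) → ℝ≥0∞)
    {c : ℝ≥0∞} (hc₀ : c ≠ 0) (hc : c ≠ ⊤) :
    NNorm u v Ψ (fun x => c * f x) ≤ c * NNorm u v Ψ f := by
  rw [NNorm, NNorm, ← lintegral_const_mul' _ _ hc]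
  refine lintegral_mono fun s => ?_
  simp only [← mul_div_assoc]
  gcongr
  exact rearrangementE_const_mul_le _ _ hc₀ hc s

lemma NNorm_tsum_le {n : ℕ} (u v : (Fin n → ℝ) → ℝ) {Ψ : ℝ → ℝ} (hΨ : IsYoung Ψ)
    {f : ℕ → (Fin n → ℝ) → ℝ≥0∞} (hf : ∀ k, Measurable (f k)) :
    NNorm u v Ψ (fun x => ∑' k, f k x) ≤ ∑' k, NNorm u v Ψ (f k) := by
  have : SFinite (wMeasure u v) :=
    sFinite_of_absolutelyContinuous (withDensity_absolutelyContinuous volume _)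
  set φ : ℝ → ℝ≥0∞ := fun s => if 0 < s then
    (ENNReal.ofReal (Function.invFunOn Ψ (Ici 0) (1 / s)))⁻¹ * (ENNReal.ofReal s)⁻¹ else ⊤
  have hφ : Antitone φ := by
    intro s t hst
    by_cases hs : 0 < s
    · simpa only [φ, if_pos hs, if_pos (hs.trans_le hst)] using
        hΨ.antitone_inv_mul hs (hs.trans_le hst) hst
    · simp [φ, hs]
  have key (g : (Fin n → ℝ) → ℝ≥0∞) : NNorm u v Ψ g =
      ∫⁻ s in Ioi (0 : ℝ), rearrangementE (wMeasure u v) g s * φ s :=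
    setLIntegral_congr_fun measurableSet_Ioi fun s hs => by
      simp only [φ, if_pos (mem_Ioi.1 hs), div_eq_mul_inv, mul_assoc]
  simp only [key]
  exact lintegral_rearrangementE_tsum_mul_le _ hf hφ

lemma cube_eq_closedBall {n : ℕ} (c : Fin n → ℝ) {r : ℝ} (hr : 0 ≤ r) :
    cube c r = Metric.closedBall c r := by
  ext y
  simp only [cube, mem_ofPred_eq, Metric.mem_closedBall, dist_pi_le_iff hr, Real.dist_eq]

lemma maximalE_congr_ae {n : ℕ} {f g : (Fin n → ℝ) → ℝ≥0∞} (hfg : f =ᵐ[volume] g) :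
    maximalE f = maximalE g := by
  ext x
  simp only [maximalE, lintegral_congr_ae (ae_restrict_of_ae hfg)]

lemma le_maximalE {n : ℕ} (f : (Fin n → ℝ) → ℝ≥0∞) {x c : Fin n → ℝ} {r : ℝ} (hr : 0 < r)
    (hx : x ∈ cube c r) :
    (volume (cube c r))⁻¹ * ∫⁻ y in cube c r, f y ≤ maximalE f x :=
  le_iSup₂_of_le c r <| le_iSup₂_of_le hr hx le_rfl

lemma maximalE_tsum_le {n : ℕ} {f : ℕ → (Fin n → ℝ) → ℝ≥0∞}
    (hf : ∀ k, AEMeasurable (f k) volume) (x : Fin n → ℝ) :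
    maximalE (fun y => ∑' k, f k y) x ≤ ∑' k, maximalE (f k) x := by
  refine iSup₂_le fun c r => iSup₂_le fun hr hx => ?_
  rw [lintegral_tsum fun k => (hf k).restrict, ← ENNReal.tsum_mul_left]
  exact ENNReal.tsum_le_tsum fun k => le_maximalE (f k) hr hx

lemma maximalE_const_mul {n : ℕ} (f : (Fin n → ℝ) → ℝ≥0∞) {a : ℝ≥0∞} (ha : a ≠ ⊤)
    (x : Fin n → ℝ) : maximalE (fun y => a * f y) x = a * maximalE f x := by
  simp only [maximalE, lintegral_const_mul' _ _ ha, ENNReal.mul_iSup, mul_left_comm]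

lemma measurable_maximalE {n : ℕ} (f : (Fin n → ℝ) → ℝ≥0∞) : Measurable (maximalE f) := by
  refine LowerSemicontinuous.measurable fun x a ha => ?_
  simp only [maximalE, lt_iSup_iff] at ha
  obtain ⟨c, r, hr, hx, ha⟩ := ha
  have hvol {q : ℝ} (hq : 0 < q) : volume (cube c q) = ENNReal.ofReal ((2 * q) ^ n) := by
    rw [cube_eq_closedBall c hq.le, Real.volume_pi_closedBall c hq.le, Fintype.card_fin]
  rw [hvol hr] at ha
  have hcont : Filter.Tendsto
      (fun q : ℝ => (ENNReal.ofReal ((2 * q) ^ n))⁻¹ * ∫⁻ y in cube c r, f y)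
      (nhdsWithin r (Ioi r))
      (nhds ((ENNReal.ofReal ((2 * r) ^ n))⁻¹ * ∫⁻ y in cube c r, f y)) := by
    refine ENNReal.Tendsto.mul_const ?_ (Or.inl (by simp))
    refine Filter.Tendsto.mono_left (Continuous.tendsto ?_ r) nhdsWithin_le_nhds
    exact (ENNReal.continuous_ofReal.comp (by fun_prop)).inv
  obtain ⟨q, hq, hrq⟩ := ((hcont.eventually (lt_mem_nhds ha)).and self_mem_nhdsWithin).exists
  have hrq : r < q := hrq
  rw [cube_eq_closedBall c hr.le] at hx
  filter_upwards [Metric.isOpen_ball.mem_nhds (Metric.closedBall_subset_ball hrq hx)] with y hy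
  refine hq.trans_le (le_trans ?_ (le_maximalE f (c := c) (hr.trans hrq) ?_))
  · rw [hvol (hr.trans hrq)]
    gcongr
    exact fun z hz i => (hz i).trans hrq.le
  · rw [cube_eq_closedBall c (hr.trans hrq).le]
    exact Metric.ball_subset_closedBall hy

lemma measurable_Sop {n : ℕ} {u : (Fin n → ℝ) → ℝ} (hu : Measurable u)
    (f : (Fin n → ℝ) → ℝ≥0∞) : Measurable (Sop u f) :=
  (measurable_maximalE _).div hu.ennreal_ofReal

lemma Sop_congr_ae {n : ℕ} {u w : (Fin n → ℝ) → ℝ} {f g : (Fin n → ℝ) → ℝ≥0∞}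
    (huw : u =ᵐ[volume] w) (hfg : f =ᵐ[volume] g) : Sop u f =ᵐ[volume] Sop w g := by
  have : maximalE (fun y => f y * ENNReal.ofReal (u y)) =
      maximalE (fun y => g y * ENNReal.ofReal (w y)) :=
    maximalE_congr_ae <| by
      filter_upwards [huw, hfg] with x hx hx'
      rw [hx, hx']
  filter_upwards [huw] with x hx
  simp only [Sop, this, hx]

lemma iterate_Sop_congr_ae {n : ℕ} {u w : (Fin n → ℝ) → ℝ} (huw : u =ᵐ[volume] w)
    (f : (Fin n → ℝ) → ℝ≥0∞) (k : ℕ) : (Sop u)^[k] f =ᵐ[volume] (Sop w)^[k] f := by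
  induction k with
  | zero => rfl
  | succ k ih =>
    rw [Function.iterate_succ_apply', Function.iterate_succ_apply']
    exact Sop_congr_ae huw ih

lemma measurable_iterate_Sop {n : ℕ} {u : (Fin n → ℝ) → ℝ} (hu : Measurable u)
    {f : (Fin n → ℝ) → ℝ≥0∞} (hf : Measurable f) (k : ℕ) : Measurable ((Sop u)^[k] f) := by
  cases k with
  | zero => exact hf
  | succ k =>
    rw [Function.iterate_succ_apply']
    exact measurable_Sop hu _

/-- Countable subadditivity and homogeneity of `S` along the Rubio de Francia series. -/
lemma Sop_Rop_le {n : ℕ} {u : (Fin n → ℝ) → ℝ} (hu : AEMeasurable u volume) {K₀ : ℝ}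
    (hK₀ : 0 < K₀) {h : (Fin n → ℝ) → ℝ≥0∞} (hh : Measurable h) (x : Fin n → ℝ) :
    Sop u (Rop u K₀ h) x ≤ ENNReal.ofReal (2 * K₀) * Rop u K₀ h x := by
  set a := ENNReal.ofReal (2 * K₀)
  have ha₀ : a ≠ 0 := by simpa [a] using hK₀
  have ha : a ≠ ⊤ := ENNReal.ofReal_ne_top
  have hpow (k : ℕ) : (a ^ k)⁻¹ ≠ ⊤ := ENNReal.inv_ne_top.2 (pow_ne_zero k ha₀)
  have hmeas (k : ℕ) : AEMeasurable ((Sop u)^[k] h) volume :=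
    (measurable_iterate_Sop hu.measurable_mk hh k).aemeasurable.congr
      (iterate_Sop_congr_ae hu.ae_eq_mk h k).symm
  have hprod : (fun y => Rop u K₀ h y * ENNReal.ofReal (u y)) =
      fun y => ∑' k, (a ^ k)⁻¹ * ((Sop u)^[k] h y * ENNReal.ofReal (u y)) := by
    ext y
    rw [Rop, ← ENNReal.tsum_mul_right]
    exact tsum_congr fun k => by rw [ENNReal.div_eq_inv_mul, mul_assoc]
  calc Sop u (Rop u K₀ h) x
      ≤ (∑' k, (a ^ k)⁻¹ * maximalE (fun y => (Sop u)^[k] h y * ENNReal.ofReal (u y)) x) /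
          ENNReal.ofReal (u x) := by
        rw [Sop, hprod]
        gcongr
        refine (maximalE_tsum_le (fun k => ?_) x).trans_eq ?_
        · exact ((hmeas k).mul hu.ennreal_ofReal).const_mul _
        · exact tsum_congr fun k => maximalE_const_mul _ (hpow k) x
    _ = ∑' k, (a ^ k)⁻¹ * (Sop u)^[k + 1] h x := by
        rw [div_eq_mul_inv, ← ENNReal.tsum_mul_right]
        refine tsum_congr fun k => ?_
        rw [Function.iterate_succ_apply', Sop, div_eq_mul_inv, mul_assoc]
    _ = a * ∑' k, (Sop u)^[k + 1] h x / a ^ (k + 1) := by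
        rw [← ENNReal.tsum_mul_left]
        refine tsum_congr fun k => ?_
        rw [ENNReal.div_eq_inv_mul, pow_succ', ENNReal.mul_inv (Or.inl ha₀) (Or.inl ha),
          ← mul_assoc, ← mul_assoc, ENNReal.mul_inv_cancel ha₀ ha, one_mul]
    _ ≤ a * Rop u K₀ h x := by
        gcongr
        exact ENNReal.tsum_comp_le_tsum_of_injective (add_left_injective 1)
          fun k => (Sop u)^[k] h x / a ^ k

lemma NNorm_iterate_Sop_le {n : ℕ} {u v w : (Fin n → ℝ) → ℝ} (hw : Measurable w) {Ψ : ℝ → ℝ}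
    {K : ℝ≥0∞} (hS : ∀ h : (Fin n → ℝ) → ℝ≥0∞, Measurable h →
      NNorm u v Ψ (Sop w h) ≤ K * NNorm u v Ψ h)
    {h : (Fin n → ℝ) → ℝ≥0∞} (hh : Measurable h) (k : ℕ) :
    NNorm u v Ψ ((Sop w)^[k] h) ≤ K ^ k * NNorm u v Ψ h := by
  induction k with
  | zero => simp
  | succ k ih =>
    rw [Function.iterate_succ_apply', pow_succ', mul_assoc]
    exact (hS _ (measurable_iterate_Sop hw hh k)).trans (by gcongr)

lemma NNorm_Rop_le {n : ℕ} {u v : (Fin n → ℝ) → ℝ} (hu : AEMeasurable u volume)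
    {Ψ : ℝ → ℝ} (hΨ : IsYoung Ψ) {K₀ : ℝ} (hK₀ : 0 < K₀)
    (hS : ∀ h : (Fin n → ℝ) → ℝ≥0∞, Measurable h →
      NNorm u v Ψ (Sop u h) ≤ ENNReal.ofReal K₀ * NNorm u v Ψ h)
    {h : (Fin n → ℝ) → ℝ≥0∞} (hh : Measurable h) :
    NNorm u v Ψ (Rop u K₀ h) ≤ 2 * NNorm u v Ψ h := by
  set w := hu.mk u
  have huw : u =ᵐ[volume] w := hu.ae_eq_mk
  have hw : Measurable w := hu.measurable_mk
  set a := ENNReal.ofReal (2 * K₀) with ha_def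
  set K := ENNReal.ofReal K₀
  have hK : K ≠ 0 := by simpa [K] using hK₀
  have hK_top : K ≠ ⊤ := ENNReal.ofReal_ne_top
  have haK : a = 2 * K := by rw [ha_def, ENNReal.ofReal_mul zero_le_two, ENNReal.ofReal_ofNat]
  have ha₀ : a ≠ 0 := by simpa [a] using hK₀
  have ha : a ≠ ⊤ := ENNReal.ofReal_ne_top
  have hSw (f : (Fin n → ℝ) → ℝ≥0∞) (hf : Measurable f) :
      NNorm u v Ψ (Sop w f) ≤ K * NNorm u v Ψ f := by
    rw [← NNorm_congr_ae (Sop_congr_ae huw (Filter.EventuallyEq.refl _ f))]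
    exact hS f hf
  have hR : Rop u K₀ h =ᵐ[volume] fun x => ∑' k, (a ^ k)⁻¹ * (Sop w)^[k] h x := by
    filter_upwards [ae_all_iff.2 (iterate_Sop_congr_ae huw h)] with x hx
    exact tsum_congr fun k => by rw [hx k, ENNReal.div_eq_inv_mul]
  calc NNorm u v Ψ (Rop u K₀ h)
      = NNorm u v Ψ (fun x => ∑' k, (a ^ k)⁻¹ * (Sop w)^[k] h x) := NNorm_congr_ae hR
    _ ≤ ∑' k, NNorm u v Ψ (fun x => (a ^ k)⁻¹ * (Sop w)^[k] h x) :=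
        NNorm_tsum_le u v hΨ fun k => (measurable_iterate_Sop hw hh k).const_mul _
    _ ≤ ∑' k, 2⁻¹ ^ k * NNorm u v Ψ h := by
        refine ENNReal.tsum_le_tsum fun k => ?_
        calc NNorm u v Ψ (fun x => (a ^ k)⁻¹ * (Sop w)^[k] h x)
            ≤ (a ^ k)⁻¹ * NNorm u v Ψ ((Sop w)^[k] h) :=
              NNorm_const_mul_le u v Ψ _ (ENNReal.inv_ne_zero.2 (ENNReal.pow_ne_top ha))
                (ENNReal.inv_ne_top.2 (pow_ne_zero k ha₀))
          _ ≤ (a ^ k)⁻¹ * (K ^ k * NNorm u v Ψ h) := by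
              gcongr
              exact NNorm_iterate_Sop_le hw hSw hh k
          _ = 2⁻¹ ^ k * NNorm u v Ψ h := by
              rw [← mul_assoc, ENNReal.inv_pow, ← mul_pow, haK,
                ENNReal.mul_inv (Or.inl two_ne_zero) (Or.inl ENNReal.ofNat_ne_top), mul_assoc,
                ENNReal.inv_mul_cancel hK hK_top, mul_one]
    _ = 2 * NNorm u v Ψ h := by
        rw [ENNReal.tsum_mul_right, ENNReal.tsum_geometric, ENNReal.one_sub_inv_two, inv_inv]

/-- The Rubio de Francia algorithm: if `u ∈ A₁`, `v` is a weight, `Ψ` is a Young function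
and `N(Sh) ≤ K₀ N(h)` for all measurable `h`, then for every nonnegative measurable `h`
with `N(h) < ∞`: (i) `h ≤ Rh` a.e.; (ii) `N(Rh) ≤ 2N(h)`; (iii) `S(Rh) ≤ 2K₀ Rh` a.e.,
equivalently `M((Rh)u) ≤ 2K₀ (Rh)u` a.e.; in particular `(Rh)u ∈ A₁` with
`[(Rh)u]_{A₁} ≤ 2K₀`. -/
theorem rubio_de_francia_algorithm
    (n : ℕ) (u v : (Fin n → ℝ) → ℝ) (hu : MemA1 u) (hv : IsWeight v)
    (Ψ : ℝ → ℝ) (hΨ : IsYoung Ψ) (K₀ : ℝ) (hK₀ : 0 < K₀)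
    (hS : ∀ h : (Fin n → ℝ) → ℝ≥0∞, Measurable h →
      NNorm u v Ψ (Sop u h) ≤ ENNReal.ofReal K₀ * NNorm u v Ψ h) :
    ∀ h : (Fin n → ℝ) → ℝ≥0∞, Measurable h → NNorm u v Ψ h < ⊤ →
      (∀ᵐ x, h x ≤ Rop u K₀ h x) ∧
      NNorm u v Ψ (Rop u K₀ h) ≤ 2 * NNorm u v Ψ h ∧
      (∀ᵐ x, Sop u (Rop u K₀ h) x ≤ ENNReal.ofReal (2 * K₀) * Rop u K₀ h x) ∧
      (∀ᵐ x, maximalE (fun y => Rop u K₀ h y * ENNReal.ofReal (u y)) x ≤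
        ENNReal.ofReal (2 * K₀) * (Rop u K₀ h x * ENNReal.ofReal (u x))) ∧
      A1constE (fun x => Rop u K₀ h x * ENNReal.ofReal (u x)) ≤ ENNReal.ofReal (2 * K₀) := by
  intro h hh _
  have hum : AEMeasurable u volume := hu.1.1.aestronglyMeasurable.aemeasurable
  have hSR := Sop_Rop_le hum hK₀ hh
  have hM : ∀ᵐ x, maximalE (fun y => Rop u K₀ h y * ENNReal.ofReal (u y)) x ≤
      ENNReal.ofReal (2 * K₀) * (Rop u K₀ h x * ENNReal.ofReal (u x)) := by
    filter_upwards [hu.1.2] with x hx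
    rw [← mul_assoc]
    exact (ENNReal.div_le_iff (ENNReal.ofReal_pos.2 hx).ne' ENNReal.ofReal_ne_top).1 (hSR x)
  refine ⟨Filter.Eventually.of_forall fun x => ?_, NNorm_Rop_le hum hΨ hK₀ hS hh,
    Filter.Eventually.of_forall hSR, hM, essSup_le_of_ae_le _ ?_⟩
  · refine le_trans ?_ (ENNReal.le_tsum 0)
    simp
  · filter_upwards [hM] with x hx
    exact ENNReal.div_le_of_le_mul hx

end
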